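/- For all X, Y, Z ∈ 𝔤 one has R̃(X^v, Y^v)Z^v = (∇²_X(φ(∇²_Y Z − ½[Y,Z])) + ½(ad₂ X)*φ(∇²_Y Z − ½[Y,Z]))^v − (∇²_Y(φ(∇²_X Z − ½[X,Z])) + ½(ad₂ Y)*φ(∇²_X Z − ½[X,Z]))^v. -/

import Mathlib

/-- `g` is an inner product (symmetric positive-definite bilinear form) on a real vector space. -/
structure IsInnerProd {L : Type*} [AddCommGroup L] [Module ℝ L] (g : L → L → ℝ) : Prop where
  addLeft : ∀ x y z : L, g (x + y) z = g x z + g y z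
  smulLeft : ∀ (a : ℝ) (x y : L), g (a • x) y = a * g x y
  symm : ∀ x y : L, g x y = g y x
  posDef : ∀ x : L, x ≠ 0 → 0 < g x x

/-- The bracket of the tangent Lie algebra `T𝔤 = 𝔤 × 𝔤`:
`[(X₁,Y₁),(X₂,Y₂)] = ([X₁,X₂], [X₁,Y₂] + [Y₁,X₂])`.
The complete lift of `X` is `(X, 0)` and the vertical lift is `(0, X)`. -/
def tbr {L : Type*} [LieRing L] (A B : L × L) : L × L :=
  (⁅A.1, B.1⁆, ⁅A.1, B.2⁆ + ⁅A.2, B.1⁆)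

/-- The lifted inner product `g̃` on `T𝔤 = 𝔤 × 𝔤` determined by
`g̃(X^c,Y^c) = ⟨X,Y⟩₁`, `g̃(X^v,Y^v) = ⟨X,Y⟩₂`, `g̃(X^c,Y^v) = 0`. -/
def tg {L : Type*} (g1 g2 : L → L → ℝ) (A B : L × L) : ℝ :=
  g1 A.1 B.1 + g2 A.2 B.2

/-- `nab` is the Levi-Civita connection of the metric `g` with respect to the bracket `br`,
i.e. it satisfies the Koszul formula
`2⟨∇_X Y, Z⟩ = ⟨[X,Y],Z⟩ − ⟨[Y,Z],X⟩ + ⟨[Z,X],Y⟩`. -/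
def IsLC {V : Type*} [AddCommGroup V] [Module ℝ V] (br : V → V → V)
    (g : V → V → ℝ) (nab : V → V → V) : Prop :=
  ∀ X Y Z : V, 2 * g (nab X Y) Z = g (br X Y) Z - g (br Y Z) X + g (br Z X) Y

/-- The curvature tensor `R(X,Y)Z = ∇_X ∇_Y Z − ∇_Y ∇_X Z − ∇_{[X,Y]} Z`. -/
def curvOf {V : Type*} [AddCommGroup V] (br nab : V → V → V) (X Y Z : V) : V :=
  nab X (nab Y Z) - nab Y (nab X Z) - nab (br X Y) Z

namespace IsInnerProd

variable {L : Type*} [AddCommGroup L] [Module ℝ L] {g : L → L → ℝ}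

theorem neg_left (hg : IsInnerProd g) (x y : L) : g (-x) y = -g x y := by
  simpa using hg.smulLeft (-1) x y

theorem sub_left (hg : IsInnerProd g) (x y z : L) : g (x - y) z = g x z - g y z := by
  rw [sub_eq_add_neg, hg.addLeft, hg.neg_left, sub_eq_add_neg]

theorem zero_left (hg : IsInnerProd g) (y : L) : g 0 y = 0 := by
  simpa using hg.smulLeft 0 0 y

theorem zero_right (hg : IsInnerProd g) (x : L) : g x 0 = 0 := by
  rw [hg.symm, hg.zero_left]

theorem ext_left (hg : IsInnerProd g) {x y : L} (h : ∀ z, g x z = g y z) : x = y := by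
  by_contra hne
  have hpos := hg.posDef (x - y) (sub_ne_zero.mpr hne)
  rw [hg.sub_left, h, sub_self] at hpos
  exact hpos.false

theorem self_nonneg (hg : IsInnerProd g) (x : L) : 0 ≤ g x x := by
  rcases eq_or_ne x 0 with rfl | hx
  · rw [hg.zero_left]
  · exact (hg.posDef x hx).le

/-- The lift of two inner products is an inner product. -/
theorem tg {g1 g2 : L → L → ℝ} (hg1 : IsInnerProd g1) (hg2 : IsInnerProd g2) :
    IsInnerProd (tg g1 g2) where
  addLeft x y z := by
    simp only [_root_.tg, Prod.fst_add, Prod.snd_add, hg1.addLeft, hg2.addLeft]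
    ring
  smulLeft a x y := by
    simp only [_root_.tg, Prod.smul_fst, Prod.smul_snd, hg1.smulLeft, hg2.smulLeft]
    ring
  symm x y := by simp only [_root_.tg, hg1.symm x.1, hg2.symm x.2]
  posDef := by
    rintro ⟨a, b⟩ hx
    rcases eq_or_ne a 0 with rfl | ha
    · exact add_pos_of_nonneg_of_pos (hg1.self_nonneg 0)
        (hg2.posDef b fun hb => hx (by rw [hb]; rfl))
    · exact add_pos_of_pos_of_nonneg (hg1.posDef a ha) (hg2.self_nonneg b)

end IsInnerProd

namespace IsLC

variable {L : Type*} [LieRing L] [Module ℝ L] {g1 g2 : L → L → ℝ}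
  {nab : L → L → L} {tnab : L × L → L × L → L × L}

theorem zero_left {V : Type*} [AddCommGroup V] [Module ℝ V] {br nab : V → V → V} {g : V → V → ℝ}
    (h : IsLC br g nab) (hg : IsInnerProd g) (hl : ∀ X, br 0 X = 0) (hr : ∀ X, br X 0 = 0)
    (Y : V) : nab 0 Y = 0 := by
  refine hg.ext_left fun Z => ?_
  have hk := h 0 Y Z
  rw [hl, hr, hg.zero_left, hg.zero_right, hg.zero_left] at hk
  rw [hg.zero_left]
  linarith

/-- The lifted connection on two vertical lifts is the complete lift of `φ(∇²_X Y - ½[X,Y])`. -/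
theorem vertical_vertical (htn : IsLC tbr (tg g1 g2) tnab) (hg1 : IsInnerProd g1)
    (hg2 : IsInnerProd g2) (hn : IsLC (fun X Y : L => ⁅X, Y⁆) g2 nab) {phi : L → L}
    (hphi : ∀ X Y : L, g2 X Y = g1 (phi X) Y) (X Y : L) :
    tnab (0, X) (0, Y) = (phi (nab X Y - ((1 : ℝ) / 2) • ⁅X, Y⁆), 0) := by
  refine (hg1.tg hg2).ext_left fun Z => ?_
  have hk := htn (0, X) (0, Y) Z
  have hk2 := hn X Y Z.1
  simp only [tbr, tg, zero_lie, lie_zero, zero_add, add_zero, hg1.zero_left,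
    hg2.zero_left] at hk hk2 ⊢
  rw [← hphi, hg2.sub_left, hg2.smulLeft]
  linarith

/-- The lifted connection of a complete lift along a vertical lift is the vertical lift of
`∇²_X W + ½(ad₂ X)*W`. -/
theorem vertical_complete (htn : IsLC tbr (tg g1 g2) tnab) (hg1 : IsInnerProd g1)
    (hg2 : IsInnerProd g2) (hn : IsLC (fun X Y : L => ⁅X, Y⁆) g2 nab) {ads : L → L → L}
    (hads : ∀ X Y Z : L, g2 (ads X Y) Z = g2 Y ⁅X, Z⁆) (X W : L) :
    tnab (0, X) (W, 0) = (0, nab X W + ((1 : ℝ) / 2) • ads X W) := by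
  refine (hg1.tg hg2).ext_left fun Z => ?_
  have hk := htn (0, X) (W, 0) Z
  have hk2 := hn X W Z.2
  have had : g2 (ads X W) Z.2 = -g2 ⁅Z.2, X⁆ W := by
    rw [hads, hg2.symm, ← lie_skew, hg2.neg_left]
  simp only [tbr, tg, zero_lie, lie_zero, zero_add, add_zero, hg1.zero_left, hg1.zero_right,
    hg2.zero_right] at hk hk2 ⊢
  rw [hg2.addLeft, hg2.smulLeft, had]
  linarith

end IsLC

theorem statement13 {L : Type*} [LieRing L] [Module ℝ L] [LieAlgebra ℝ L]
    [FiniteDimensional ℝ L]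
    (g1 g2 : L → L → ℝ) (hg1 : IsInnerProd g1) (hg2 : IsInnerProd g2)
    (nabla1 nabla2 : L → L → L)
    (hn1 : IsLC (fun X Y : L => ⁅X, Y⁆) g1 nabla1)
    (hn2 : IsLC (fun X Y : L => ⁅X, Y⁆) g2 nabla2)
    (tnabla : L × L → L × L → L × L)
    (htn : IsLC tbr (tg g1 g2) tnabla)
    (phi : L →ₗ[ℝ] L)
    (hphi : ∀ X Y : L, g2 X Y = g1 (phi X) Y)
    (ads : L → L → L)
    (hads : ∀ X Y Z : L, g2 (ads X Y) Z = g2 Y ⁅X, Z⁆) :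
    ∀ X Y Z : L,
      curvOf tbr tnabla (0, X) (0, Y) (0, Z)
        = ((0 : L),
            nabla2 X (phi (nabla2 Y Z - ((1 : ℝ) / 2) • ⁅Y, Z⁆))
              + ((1 : ℝ) / 2) • ads X (phi (nabla2 Y Z - ((1 : ℝ) / 2) • ⁅Y, Z⁆)))
          - ((0 : L),
              nabla2 Y (phi (nabla2 X Z - ((1 : ℝ) / 2) • ⁅X, Z⁆))
                + ((1 : ℝ) / 2) • ads Y (phi (nabla2 X Z - ((1 : ℝ) / 2) • ⁅X, Z⁆))) := by
  intro X Y Z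
  have hvv := htn.vertical_vertical hg1 hg2 hn2 hphi
  have hvc := htn.vertical_complete hg1 hg2 hn2 hads
  have hbr : tbr ((0 : L), X) (0, Y) = 0 := by simp [tbr]
  have hzero : tnabla 0 (0, Z) = 0 :=
    htn.zero_left (hg1.tg hg2) (fun A => by simp [tbr]) (fun A => by simp [tbr]) _
  rw [curvOf, hbr, hzero, sub_zero, hvv, hvv, hvc, hvc]
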